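/- Assume L is regular, i.e. the Hessian W(t, q_0, …, q_k) is invertible at every point. Let q_0, …, q_{2k−1} : ℝ → ℝⁿ be smooth curves satisfying the partial holonomy conditions q_i′ = q_{i+1} for 0 ≤ i ≤ k−1, and define momentum curves p^i(t) = \hat p^i(t, q_0(t), …, q_{2k−1−i}(t)) using the Jacobi–Ostrogradsky momentum functions. If for all t one has (p^0)′(t) = (∂L/∂q_0)(t, q_0(t), …, q_k(t)) and (p^i)′(t) = (∂L/∂q_i)(t, q_0(t), …, q_k(t)) − p^{i−1}(t) for 1 ≤ i ≤ k−1, then the full holonomy conditions q_j′ = q_{j+1} hold for all k ≤ j ≤ 2k−2 (hence q_i = q_0^{(i)} for 0 ≤ i ≤ 2k−1), and q_0 satisfies the k-th order Euler–Lagrange equation Σ_{i=0}^{k} (−1)^i (dⁱ/dtⁱ)[(∂L/∂q_i) ∘ j^k q_0](t) = 0 for all t. -/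

import Mathlib

open scoped ContDiff RealInnerProductSpace

noncomputable section

/-- `ℝⁿ` as a Euclidean space. -/
abbrev Evec (n : ℕ) := EuclideanSpace ℝ (Fin n)

/-- The partial gradient `∂f/∂q_i` of a function `f : ℝ × (ℝⁿ)^N → ℝ`
with respect to the variable `q_i`. -/
noncomputable def pgradN {n N : ℕ} (f : ℝ × (Fin N → Evec n) → ℝ)
    (i : Fin N) (x : ℝ × (Fin N → Evec n)) : Evec n :=
  gradient (fun v => f (x.1, Function.update x.2 i v)) (x.2 i)

/-- The total time derivative `d_T f = ∂f/∂t + ∑_i q_{i+1} · ∂f/∂q_i` of a function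
on `ℝ × (ℝⁿ)^N` (functions of `(t, q_0, …, q_m)` are regarded as functions on this
space, not depending on the higher variables, for which the extra terms vanish). -/
noncomputable def dT {n N : ℕ} {F : Type*} [NormedAddCommGroup F] [NormedSpace ℝ F]
    (f : ℝ × (Fin N → Evec n) → F) : ℝ × (Fin N → Evec n) → F :=
  fun x => deriv (fun s => f (s, x.2)) x.1 +
    ∑ i : Fin N, if h : (i : ℕ) + 1 < N then
      fderiv ℝ (fun v => f (x.1, Function.update x.2 i v)) (x.2 i) (x.2 ⟨(i : ℕ)+1, h⟩)
    else 0

/-- A `k`-th order Lagrangian regarded as a function on `ℝ × (ℝⁿ)^N`, `k+1 ≤ N`. -/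
def extendL {n k N : ℕ} (h : k + 1 ≤ N) (L : ℝ × (Fin (k+1) → Evec n) → ℝ) :
    ℝ × (Fin N → Evec n) → ℝ :=
  fun x => L (x.1, fun i => x.2 ⟨(i : ℕ), by have := i.isLt; omega⟩)

/-- The Jacobi–Ostrogradsky momentum function
`p̂^{r-1} = ∑_{i=0}^{k-r} (-1)^i d_T^i (∂L/∂q_{r+i})`, as a function on `ℝ × (ℝⁿ)^N`. -/
noncomputable def hatP {n k N : ℕ} (h : k + 1 ≤ N) (L : ℝ × (Fin (k+1) → Evec n) → ℝ)
    (r : ℕ) (hr1 : 1 ≤ r) (hrk : r ≤ k) : ℝ × (Fin N → Evec n) → Evec n :=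
  fun x => ∑ i : Fin (k - r + 1),
    ((-1:ℝ)^(i : ℕ)) •
      (dT^[(i : ℕ)] (pgradN (extendL h L) ⟨r + (i : ℕ), by have := i.isLt; omega⟩)) x

/-- The Hessian matrix `W` of a `k`-th order Lagrangian with respect to the highest
velocity variable `q_k`: `W A B = ∂²L/∂q_k^B ∂q_k^A`. -/
noncomputable def hessQk {n k : ℕ} (L : ℝ × (Fin (k+1) → Evec n) → ℝ)
    (x : ℝ × (Fin (k+1) → Evec n)) : Matrix (Fin n) (Fin n) ℝ :=
  fun A B =>
    fderiv ℝ (fun v => gradient (fun w => L (x.1, Function.update x.2 (Fin.last k) w)) v A)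
      (x.2 (Fin.last k)) (EuclideanSpace.single B 1)

/-- The restricted Legendre–Ostrogradsky map
`FL(t, q_0, …, q_{2k-1}) = (t, q_0, …, q_{k-1}, p̂^0, …, p̂^{k-1})`. -/
noncomputable def legendreFL {n k : ℕ} (hk : 1 ≤ k) (L : ℝ × (Fin (k+1) → Evec n) → ℝ) :
    ℝ × (Fin (2*k) → Evec n) → ℝ × (Fin (2*k) → Evec n) :=
  fun x => (x.1, fun j => if h : (j : ℕ) < k then x.2 ⟨(j : ℕ), by omega⟩
    else hatP (by omega) L ((j : ℕ) - k + 1) (by omega)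
      (by have := j.isLt; omega) x)

/-- Truncation of a point of `ℝ × (ℝⁿ)^{2k}` to a point of `ℝ × (ℝⁿ)^{k+1}`. -/
def truncK {n k : ℕ} (hk : 1 ≤ k) (w : ℝ × (Fin (2*k) → Evec n)) :
    ℝ × (Fin (k+1) → Evec n) :=
  (w.1, fun i => w.2 ⟨(i : ℕ), by have := i.isLt; omega⟩)


/-- The jet prolongation `t ↦ (t, φ(t), φ'(t), …, φ^{(N-1)}(t))` of a curve `φ : ℝ → ℝⁿ`. -/
noncomputable def jetN {n : ℕ} (N : ℕ) (φ : ℝ → Evec n) (t : ℝ) :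
    ℝ × (Fin N → Evec n) := (t, fun i => iteratedDeriv (i : ℕ) φ t)

section DependsUpTo

variable {n N : ℕ} {F : Type*}

/-- The function `f` of `(t, q_0, …, q_{N-1})` only depends on `(t, q_0, …, q_m)`. -/
def DependsUpTo (m : ℕ) (f : ℝ × (Fin N → Evec n) → F) : Prop :=
  ∀ x y : ℝ × (Fin N → Evec n), x.1 = y.1 → (∀ j : Fin N, (j : ℕ) ≤ m → x.2 j = y.2 j) →
    f x = f y

lemma DependsUpTo.mono {m m' : ℕ} {f : ℝ × (Fin N → Evec n) → F} (hf : DependsUpTo m f)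
    (h : m ≤ m') : DependsUpTo m' f :=
  fun x y h1 h2 => hf x y h1 fun j hj => h2 j (hj.trans h)

lemma DependsUpTo.sub [AddGroup F] {m : ℕ} {f g : ℝ × (Fin N → Evec n) → F} (hf : DependsUpTo m f)
    (hg : DependsUpTo m g) : DependsUpTo m (f - g) :=
  fun x y h1 h2 => congrArg₂ (· - ·) (hf x y h1 h2) (hg x y h1 h2)

end DependsUpTo

section TotalDerivative

variable {n N : ℕ} {F : Type*} [NormedAddCommGroup F] [NormedSpace ℝ F]

/-- The shifted tuple `(q_1, …, q_{N-1}, 0)` of `(q_0, …, q_{N-1})`. -/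
def shiftTuple (y : Fin N → Evec n) : Fin N → Evec n :=
  fun j => if h : (j : ℕ) + 1 < N then y ⟨(j : ℕ) + 1, h⟩ else 0

lemma contDiff_shiftTuple :
    ContDiff ℝ ∞ (shiftTuple : (Fin N → Evec n) → Fin N → Evec n) := by
  refine contDiff_pi.2 fun j => ?_
  unfold shiftTuple
  split_ifs <;> fun_prop

lemma hasFDerivAt_slice {f : ℝ × (Fin N → Evec n) → F} {x : ℝ × (Fin N → Evec n)}
    (hf : DifferentiableAt ℝ f x) (i : Fin N) :
    HasFDerivAt (fun v => f (x.1, Function.update x.2 i v))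
      ((fderiv ℝ f x).comp ((ContinuousLinearMap.inr ℝ ℝ (Fin N → Evec n)).comp
        (ContinuousLinearMap.single ℝ (fun _ : Fin N => Evec n) i))) (x.2 i) := by
  have hx : (x.1, Function.update x.2 i (x.2 i)) = x := by simp
  have h1 : HasFDerivAt f (fderiv ℝ f x) (x.1, Function.update x.2 i (x.2 i)) := by
    rw [hx]; exact hf.hasFDerivAt
  have h2 := (hasFDerivAt_const (𝕜 := ℝ) x.1 (x.2 i)).prodMk
    (hasFDerivAt_update (𝕜 := ℝ) x.2 (i := i) (x.2 i))
  refine (h1.comp (x.2 i) h2).congr_fderiv ?_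
  ext v
  simp only [ContinuousLinearMap.comp_apply]
  congr 1
  refine Prod.ext rfl (funext fun j => ?_)
  by_cases hj : j = i
  · subst hj; simp
  · simp [hj]

lemma fderiv_slice_apply {f : ℝ × (Fin N → Evec n) → F} {x : ℝ × (Fin N → Evec n)}
    (hf : DifferentiableAt ℝ f x) (i : Fin N) (v : Evec n) :
    fderiv ℝ (fun v => f (x.1, Function.update x.2 i v)) (x.2 i) v =
      fderiv ℝ f x (0, Pi.single i v) := by
  rw [(hasFDerivAt_slice hf i).fderiv]
  rfl

lemma dT_apply {f : ℝ × (Fin N → Evec n) → F} {x : ℝ × (Fin N → Evec n)}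
    (hf : DifferentiableAt ℝ f x) : dT f x = fderiv ℝ f x (1, shiftTuple x.2) := by
  have h1 : deriv (fun s => f (s, x.2)) x.1 = fderiv ℝ f x (1, 0) :=
    (HasFDerivAt.comp_hasDerivAt (f := fun s => (s, x.2)) x.1 hf.hasFDerivAt
      ((hasDerivAt_id x.1).prodMk (hasDerivAt_const x.1 x.2))).deriv
  have h2 : ((1 : ℝ), shiftTuple x.2) =
      (1, 0) + ∑ j : Fin N, ((0 : ℝ), (Pi.single j (shiftTuple x.2 j) : Fin N → Evec n)) := by
    refine Prod.ext (by simp [Prod.fst_sum]) ?_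
    simp [Prod.snd_sum, Finset.univ_sum_single]
  rw [h2, map_add, map_sum, dT, h1]
  congr 1
  refine Finset.sum_congr rfl fun j _ => ?_
  by_cases h : (j : ℕ) + 1 < N
  · simp only [h, dif_pos, fderiv_slice_apply hf, shiftTuple]
  · have h0 : ((0 : ℝ), (0 : Fin N → Evec n)) = 0 := rfl
    simp [h, shiftTuple, h0]

lemma contDiff_dT {f : ℝ × (Fin N → Evec n) → F} (hf : ContDiff ℝ ∞ f) :
    ContDiff ℝ ∞ (dT f) := by
  have : dT f = fun x => fderiv ℝ f x (1, shiftTuple x.2) :=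
    funext fun x => dT_apply (hf.differentiable (by simp) x)
  rw [this]
  exact (hf.fderiv_right (m := ∞) (by simp)).clm_apply
    (contDiff_const.prodMk (contDiff_shiftTuple.comp contDiff_snd))

lemma dT_add {f g : ℝ × (Fin N → Evec n) → F} (hf : ContDiff ℝ ∞ f) (hg : ContDiff ℝ ∞ g) :
    dT (f + g) = dT f + dT g := by
  ext1 x
  have hf' := hf.differentiable (by simp) x
  have hg' := hg.differentiable (by simp) x
  rw [Pi.add_apply, dT_apply hf', dT_apply hg', dT_apply (hf'.add hg'), fderiv_add hf' hg']
  rfl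

lemma dT_smul (c : ℝ) {f : ℝ × (Fin N → Evec n) → F} (hf : ContDiff ℝ ∞ f) :
    dT (c • f) = c • dT f := by
  ext1 x
  have hf' := hf.differentiable (by simp) x
  rw [Pi.smul_apply, dT_apply hf', dT_apply (hf'.const_smul c), fderiv_const_smul hf']
  rfl

lemma DependsUpTo.fderiv_apply_eq_zero {m : ℕ} {f : ℝ × (Fin N → Evec n) → F}
    (hm : DependsUpTo m f) {x : ℝ × (Fin N → Evec n)} (hf : DifferentiableAt ℝ f x)
    {v : Fin N → Evec n} (hv : ∀ j : Fin N, (j : ℕ) ≤ m → v j = 0) :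
    fderiv ℝ f x (0, v) = 0 := by
  rw [← hf.lineDeriv_eq_fderiv, lineDeriv]
  have : (fun s : ℝ => f (x + s • ((0 : ℝ), v))) = fun _ => f x :=
    funext fun s => hm _ _ (by simp) fun j hj => by simp [hv j hj]
  rw [this, deriv_const]

lemma DependsUpTo.dT {m : ℕ} {f : ℝ × (Fin N → Evec n) → F}
    (hm : DependsUpTo m f) (hf : Differentiable ℝ f) : DependsUpTo (m + 1) (dT f) := by
  intro x y h1 h2
  rw [dT_apply (hf x), dT_apply (hf y), ← (hf x).lineDeriv_eq_fderiv,
    ← (hf y).lineDeriv_eq_fderiv, lineDeriv, lineDeriv]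
  congr 1
  refine funext fun s => hm _ _ (by simp [h1]) fun j hj => ?_
  have h3 : shiftTuple x.2 j = shiftTuple y.2 j := by
    unfold shiftTuple
    split_ifs
    · exact h2 _ (by simpa using hj)
    · rfl
  simp [h2 j (by omega), h3]

lemma DependsUpTo.fderiv_dT_top {m : ℕ} {f : ℝ × (Fin N → Evec n) → F}
    (hm : DependsUpTo m f) (hf : ContDiff ℝ ∞ f) (hmN : m + 1 < N)
    (x : ℝ × (Fin N → Evec n)) (v : Evec n) :
    fderiv ℝ (_root_.dT f) x (0, Pi.single ⟨m + 1, hmN⟩ v) =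
      fderiv ℝ f x (0, Pi.single ⟨m, by omega⟩ v) := by
  have hf' : Differentiable ℝ f := hf.differentiable (by simp)
  rw [← ((contDiff_dT hf).differentiable (by simp) x).lineDeriv_eq_fderiv, lineDeriv]
  set w : ℝ × (Fin N → Evec n) := (0, Pi.single ⟨m + 1, hmN⟩ v) with hw
  have hline : ∀ s : ℝ, _root_.dT f (x + s • w) =
      _root_.dT f x + s • fderiv ℝ f x (0, Pi.single ⟨m, by omega⟩ v) := by
    intro s
    have hfd : fderiv ℝ f (x + s • w) = fderiv ℝ f x := by
      rw [← fderiv_comp_add_right]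
      congr 1
      refine funext fun z => hm _ _ (by simp [hw]) fun j hj => ?_
      have : j ≠ ⟨m + 1, hmN⟩ := by rintro rfl; simp at hj
      simp [hw, this]
    rw [dT_apply (hf' _), dT_apply (hf' _), hfd, ← map_smul, ← map_add]
    congr 1
    refine Prod.ext (by simp) (funext fun j => ?_)
    by_cases hj : j = ⟨m, by omega⟩
    · subst hj; simp [shiftTuple, hw, hmN]
    · have : (j : ℕ) ≠ m := fun h => hj (Fin.ext h)
      simp [shiftTuple, hw, hj, this]
  simp_rw [hline]
  have := ((hasDerivAt_id (0 : ℝ)).smul_const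
    (fderiv ℝ f x (0, Pi.single (⟨m, by omega⟩ : Fin N) v))).const_add (_root_.dT f x)
  simpa using this.deriv

end TotalDerivative

section AlternatingSum

lemma alternating_iterate_sum_succ {V : Type*} [AddCommGroup V] [Module ℝ V]
    (S : Submodule ℝ V) (D : V → V) (hmem : ∀ f ∈ S, D f ∈ S)
    (hadd : ∀ f ∈ S, ∀ g ∈ S, D (f + g) = D f + D g)
    (hsmul : ∀ c : ℝ, ∀ f ∈ S, D (c • f) = c • D f)
    (g : ℕ → V) (hg : ∀ i, g i ∈ S) (m : ℕ) :
    ∑ i ∈ Finset.range (m + 1), (-1 : ℝ) ^ i • D^[i] (g i) =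
      g 0 - D (∑ i ∈ Finset.range m, (-1 : ℝ) ^ i • D^[i] (g (i + 1))) := by
  have hiter : ∀ i, ∀ f ∈ S, D^[i] f ∈ S := by
    intro i
    induction i with
    | zero => exact fun f hf => hf
    | succ i ih => exact fun f hf => ih _ (hmem f hf)
  induction m with
  | zero =>
    have := hsmul 0 0 S.zero_mem
    simp only [zero_smul] at this
    simp [this]
  | succ m ih =>
    rw [Finset.sum_range_succ, ih, Finset.sum_range_succ _ m,
      hadd _ (S.sum_mem fun i _ => S.smul_mem _ (hiter i _ (hg _))) _
        (S.smul_mem _ (hiter m _ (hg _))), hsmul _ _ (hiter m _ (hg _)),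
      Function.iterate_succ_apply', pow_succ]
    module

/-- The space of smooth functions, as a submodule of the space of all functions. -/
def smoothSubmodule (X F : Type*) [NormedAddCommGroup X] [NormedSpace ℝ X]
    [NormedAddCommGroup F] [NormedSpace ℝ F] : Submodule ℝ (X → F) where
  carrier := {f | ContDiff ℝ ∞ f}
  add_mem' {f g} (hf : ContDiff ℝ ∞ f) (hg : ContDiff ℝ ∞ g) := hf.add hg
  zero_mem' := show ContDiff ℝ ∞ fun _ : X => (0 : F) from contDiff_const
  smul_mem' c f (hf : ContDiff ℝ ∞ f) := hf.const_smul c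

lemma alternating_dT_sum_succ {n N : ℕ} {F : Type*} [NormedAddCommGroup F] [NormedSpace ℝ F]
    (g : ℕ → ℝ × (Fin N → Evec n) → F) (hg : ∀ i, ContDiff ℝ ∞ (g i)) (m : ℕ) :
    ∑ i ∈ Finset.range (m + 1), (-1 : ℝ) ^ i • dT^[i] (g i) =
      g 0 - dT (∑ i ∈ Finset.range m, (-1 : ℝ) ^ i • dT^[i] (g (i + 1))) :=
  alternating_iterate_sum_succ (smoothSubmodule _ _) dT (fun _ hf => contDiff_dT hf)
    (fun _ hf _ hg => dT_add hf hg) (fun c _ hf => dT_smul c hf) g hg m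

lemma alternating_deriv_sum_succ {F : Type*} [NormedAddCommGroup F] [NormedSpace ℝ F]
    (g : ℕ → ℝ → F) (hg : ∀ i, ContDiff ℝ ∞ (g i)) (m : ℕ) :
    ∑ i ∈ Finset.range (m + 1), (-1 : ℝ) ^ i • deriv^[i] (g i) =
      g 0 - deriv (∑ i ∈ Finset.range m, (-1 : ℝ) ^ i • deriv^[i] (g (i + 1))) := by
  refine alternating_iterate_sum_succ (smoothSubmodule _ _) deriv
    (fun f hf => (contDiff_infty_iff_deriv.1 hf).2)
    (fun f (hf : ContDiff ℝ ∞ f) g (hg : ContDiff ℝ ∞ g) => ?_)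
    (fun c f (hf : ContDiff ℝ ∞ f) => ?_) g hg m
  · exact funext fun t => deriv_add (hf.differentiable (by simp) t)
      (hg.differentiable (by simp) t)
  · exact funext fun t => deriv_const_smul c (hf.differentiable (by simp) t)

end AlternatingSum

section Momenta

variable {n k N : ℕ}

lemma contDiff_pgradN {f : ℝ × (Fin N → Evec n) → ℝ} (hf : ContDiff ℝ ∞ f) (i : Fin N) :
    ContDiff ℝ ∞ (pgradN f i) := by
  have : pgradN f i = fun x => (InnerProductSpace.toDual ℝ (Evec n)).symm
      ((fderiv ℝ f x).comp ((ContinuousLinearMap.inr ℝ ℝ (Fin N → Evec n)).comp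
        (ContinuousLinearMap.single ℝ (fun _ : Fin N => Evec n) i))) :=
    funext fun x => by
      rw [pgradN, gradient, (hasFDerivAt_slice (hf.differentiable (by simp) x) i).fderiv]
  rw [this]
  exact (InnerProductSpace.toDual ℝ (Evec n)).symm.contDiff.comp
    ((hf.fderiv_right (m := ∞) (by simp)).clm_comp contDiff_const)

/-- Truncation of a point of `ℝ × (ℝⁿ)^N` to a point of `ℝ × (ℝⁿ)^{k+1}`. -/
def truncTo (h : k + 1 ≤ N) (x : ℝ × (Fin N → Evec n)) : ℝ × (Fin (k + 1) → Evec n) :=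
  (x.1, fun i => x.2 (Fin.castLE h i))

lemma truncTo_update (h : k + 1 ≤ N) (x : ℝ × (Fin N → Evec n)) (i : Fin (k + 1)) (v : Evec n) :
    truncTo h (x.1, Function.update x.2 (Fin.castLE h i) v) =
      ((truncTo h x).1, Function.update (truncTo h x).2 i v) := by
  refine Prod.ext rfl (funext fun j => ?_)
  by_cases hj : j = i
  · subst hj; simp [truncTo]
  · have : Fin.castLE h j ≠ Fin.castLE h i := fun e => hj (Fin.castLE_injective h e)
    simp [truncTo, hj, this]

lemma contDiff_truncTo (h : k + 1 ≤ N) :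
    ContDiff ℝ ∞ (truncTo h : ℝ × (Fin N → Evec n) → _) := by
  unfold truncTo
  fun_prop

lemma pgradN_extendL (h : k + 1 ≤ N) (L : ℝ × (Fin (k + 1) → Evec n) → ℝ) (i : Fin (k + 1)) :
    pgradN (extendL h L) (Fin.castLE h i) = pgradN L i ∘ truncTo h := by
  ext1 x
  have : (fun v => extendL h L (x.1, Function.update x.2 (Fin.castLE h i) v)) =
      fun v => L ((truncTo h x).1, Function.update (truncTo h x).2 i v) :=
    funext fun v => congrArg L (truncTo_update h x i v)
  simp only [pgradN, Function.comp_apply, this]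
  rfl

/-- The function `∂L/∂q_j` on `ℝ × (ℝⁿ)^N`, extended by zero to `j > k`. -/
def gradQ (h : k + 1 ≤ N) (L : ℝ × (Fin (k + 1) → Evec n) → ℝ) (j : ℕ) :
    ℝ × (Fin N → Evec n) → Evec n :=
  if hj : j < k + 1 then pgradN L ⟨j, hj⟩ ∘ truncTo h else 0

variable (h : k + 1 ≤ N) {L : ℝ × (Fin (k + 1) → Evec n) → ℝ}

lemma contDiff_gradQ (hL : ContDiff ℝ ∞ L) (j : ℕ) : ContDiff ℝ ∞ (gradQ h L j) := by
  unfold gradQ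
  split_ifs
  · exact (contDiff_pgradN hL _).comp (contDiff_truncTo h)
  · exact contDiff_const

lemma dependsUpTo_gradQ (j : ℕ) : DependsUpTo k (gradQ h L j) := by
  intro x y h1 h2
  unfold gradQ
  split_ifs
  · have : truncTo h x = truncTo h y :=
      Prod.ext h1 (funext fun i => h2 _ (by have := i.isLt; simp; omega))
    simp [this]
  · rfl

/-- The Jacobi–Ostrogradsky momentum function `p̂^{r-1}`, for an arbitrary index `r`. -/
def momentum (h : k + 1 ≤ N) (L : ℝ × (Fin (k + 1) → Evec n) → ℝ) (r : ℕ) :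
    ℝ × (Fin N → Evec n) → Evec n :=
  ∑ i ∈ Finset.range (k + 1 - r), (-1 : ℝ) ^ i • dT^[i] (gradQ h L (r + i))

lemma hatP_eq_momentum {r : ℕ} (hr1 : 1 ≤ r) (hrk : r ≤ k) :
    hatP h L r hr1 hrk = momentum h L r := by
  ext1 x
  rw [hatP, momentum, show k + 1 - r = k - r + 1 by omega, Finset.sum_apply,
    ← Fin.sum_univ_eq_sum_range (fun i => ((-1 : ℝ) ^ i • dT^[i] (gradQ h L (r + i))) x)]
  refine Finset.sum_congr rfl fun i _ => ?_
  have hi : r + (i : ℕ) < k + 1 := by have := i.isLt; omega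
  have : gradQ h L (r + i) = pgradN (extendL h L) ⟨r + (i : ℕ), by omega⟩ := by
    rw [gradQ, dif_pos hi]
    exact (pgradN_extendL h L ⟨r + i, hi⟩).symm
  rw [this]
  rfl

lemma momentum_eq_sub (hL : ContDiff ℝ ∞ L) {r : ℕ} (hr : r ≤ k) :
    momentum h L r = gradQ h L r - dT (momentum h L (r + 1)) := by
  have := alternating_dT_sum_succ (fun i => gradQ h L (r + i))
    (fun i => contDiff_gradQ h hL _) (k - r)
  rw [momentum, momentum, show k + 1 - r = k - r + 1 by omega,
    show k + 1 - (r + 1) = k - r by omega]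
  simpa [add_assoc, add_comm, add_left_comm] using this

lemma momentum_top : momentum h L k = gradQ h L k := by
  simp [momentum]

lemma contDiff_momentum (hL : ContDiff ℝ ∞ L) {d : ℕ} (hd : d ≤ k) :
    ContDiff ℝ ∞ (momentum h L (k - d)) := by
  induction d with
  | zero => simpa [momentum_top h] using contDiff_gradQ h hL k
  | succ d ih =>
    rw [momentum_eq_sub h hL (by omega), show k - (d + 1) + 1 = k - d by omega]
    exact (contDiff_gradQ h hL _).sub (contDiff_dT (ih (by omega)))

lemma dependsUpTo_momentum (hL : ContDiff ℝ ∞ L) {d : ℕ} (hd : d ≤ k) :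
    DependsUpTo (k + d) (momentum h L (k - d)) := by
  induction d with
  | zero => simpa [momentum_top h] using dependsUpTo_gradQ h k
  | succ d ih =>
    rw [momentum_eq_sub h hL (by omega), show k - (d + 1) + 1 = k - d by omega]
    exact ((dependsUpTo_gradQ h _).mono (by omega)).sub
      ((ih (by omega)).dT ((contDiff_momentum h hL (by omega)).differentiable (by simp)))

lemma fderiv_momentum_top (hL : ContDiff ℝ ∞ L) {d : ℕ} (hd : d ≤ k) (hdN : k + d < N)
    (x : ℝ × (Fin N → Evec n)) (v : Evec n) :
    fderiv ℝ (momentum h L (k - d)) x (0, Pi.single ⟨k + d, hdN⟩ v) =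
      (-1 : ℝ) ^ d • fderiv ℝ (gradQ h L k) x (0, Pi.single ⟨k, by omega⟩ v) := by
  induction d with
  | zero => simp [momentum_top h]
  | succ d ih =>
    have hP := contDiff_momentum h hL (d := d) (by omega)
    rw [momentum_eq_sub h hL (by omega), show k - (d + 1) + 1 = k - d by omega,
      fderiv_sub ((contDiff_gradQ h hL _).differentiable (by simp) x)
        ((contDiff_dT hP).differentiable (by simp) x), sub_apply,
      (dependsUpTo_gradQ h _).fderiv_apply_eq_zero
        ((contDiff_gradQ h hL _).differentiable (by simp) x)
        (v := Pi.single (⟨k + (d + 1), hdN⟩ : Fin N) v)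
        (fun j hj => Pi.single_eq_of_ne (by rintro rfl; simp at hj) _)]
    have := (dependsUpTo_momentum h hL (d := d) (by omega)).fderiv_dT_top hP hdN x v
    simp only [← add_assoc]
    rw [this, ih (by omega) (by omega), pow_succ]
    module

lemma hessQk_mulVec (hL : ContDiff ℝ ∞ L) (x : ℝ × (Fin N → Evec n)) (v : Evec n) :
    (hessQk L (truncTo h x)).mulVec v.ofLp =
      (fderiv ℝ (gradQ h L k) x (0, Pi.single ⟨k, by omega⟩ v)).ofLp := by
  have hG := contDiff_gradQ h hL k
  have hG' := hG.differentiable (by simp) x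
  set g : Evec n → Evec n := fun v => gradient (fun w => L ((truncTo h x).1,
    Function.update (truncTo h x).2 (Fin.last k) w)) v with hg
  have hslice : (fun v => gradQ h L k (x.1, Function.update x.2 ⟨k, by omega⟩ v)) = g := by
    funext v
    have := truncTo_update h x (Fin.last k) v
    rw [gradQ, dif_pos (Nat.lt_succ_self k)]
    change pgradN L (Fin.last k) (truncTo h (x.1, Function.update x.2 (Fin.castLE h (Fin.last k)) v))
      = _
    rw [this]
    simp [pgradN, hg]
  have hgd : HasFDerivAt g _ (x.2 ⟨k, by omega⟩) :=
    hslice ▸ hasFDerivAt_slice hG' ⟨k, by omega⟩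
  rw [← fderiv_slice_apply hG', hslice]
  have hgdiff := hgd.differentiableAt
  ext A
  have hcoord : ∀ w : Evec n, fderiv ℝ (fun v => g v A) (x.2 ⟨k, by omega⟩) w =
      (fderiv ℝ g (x.2 ⟨k, by omega⟩) w) A := fun w => by
    have := ((EuclideanSpace.proj A : Evec n →L[ℝ] ℝ).hasFDerivAt.comp _
      hgdiff.hasFDerivAt).fderiv
    exact congrArg (fun l => l w) this
  have hv : v = ∑ B, v B • EuclideanSpace.single B (1 : ℝ) := by
    ext i
    simp [Pi.single_apply]
  rw [← hcoord]
  conv_rhs => rw [hv, map_sum]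
  simp only [Matrix.mulVec, dotProduct]
  refine Finset.sum_congr rfl fun B _ => ?_
  rw [map_smul, smul_eq_mul, mul_comm]
  rfl

lemma eq_zero_of_fderiv_gradQ (hL : ContDiff ℝ ∞ L) (hreg : ∀ x, IsUnit (hessQk L x))
    (x : ℝ × (Fin N → Evec n)) (v : Evec n)
    (hv : fderiv ℝ (gradQ h L k) x (0, Pi.single ⟨k, by omega⟩ v) = 0) : v = 0 := by
  have := hessQk_mulVec h hL x v
  rw [hv] at this
  have hinj := Matrix.mulVec_injective_of_isUnit (hreg (truncTo h x))
  refine PiLp.ext fun i => congrFun (hinj (a₂ := 0) ?_) i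
  simpa using this

end Momenta

section Curves

variable {n N : ℕ} {F : Type*} [NormedAddCommGroup F] [NormedSpace ℝ F]

/-- The curve `t ↦ (t, q_0(t), …, q_{N-1}(t))`. -/
def liftCurve (N : ℕ) (q : ℕ → ℝ → Evec n) (t : ℝ) : ℝ × (Fin N → Evec n) :=
  (t, fun j => q j t)

variable {q : ℕ → ℝ → Evec n}

lemma contDiff_liftCurve (hq : ∀ i < N, ContDiff ℝ ∞ (q i)) : ContDiff ℝ ∞ (liftCurve N q) :=
  contDiff_id.prodMk (contDiff_pi.2 fun j => hq j j.isLt)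

lemma hasDerivAt_liftCurve (hq : ∀ i < N, ContDiff ℝ ∞ (q i)) (t : ℝ) :
    HasDerivAt (liftCurve N q) (1, fun j : Fin N => deriv (q j) t) t :=
  (hasDerivAt_id t).prodMk (hasDerivAt_pi.2 fun j =>
    ((hq j j.isLt).differentiable (by simp) t).hasDerivAt)

lemma deriv_comp_liftCurve_sub_dT (hq : ∀ i < N, ContDiff ℝ ∞ (q i))
    {f : ℝ × (Fin N → Evec n) → F} (hf : ContDiff ℝ ∞ f) (t : ℝ) :
    deriv (f ∘ liftCurve N q) t - dT f (liftCurve N q t) =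
      fderiv ℝ f (liftCurve N q t)
        (0, (fun j : Fin N => deriv (q j) t) - shiftTuple (liftCurve N q t).2) := by
  have hf' := hf.differentiable (by simp) (liftCurve N q t)
  rw [(hf'.hasFDerivAt.comp_hasDerivAt t (hasDerivAt_liftCurve hq t)).deriv, dT_apply hf',
    ← map_sub]
  congr 1
  simp

lemma DependsUpTo.deriv_comp_liftCurve (hq : ∀ i < N, ContDiff ℝ ∞ (q i)) {m : ℕ}
    {f : ℝ × (Fin N → Evec n) → F} (hm : DependsUpTo m f) (hf : ContDiff ℝ ∞ f)
    (hmN : m + 1 < N) {t : ℝ} (hol : ∀ j ≤ m, deriv (q j) t = q (j + 1) t) :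
    deriv (f ∘ liftCurve N q) t = _root_.dT f (liftCurve N q t) := by
  rw [← sub_eq_zero, deriv_comp_liftCurve_sub_dT hq hf]
  refine hm.fderiv_apply_eq_zero (hf.differentiable (by simp) _) fun j hj => ?_
  have : (j : ℕ) + 1 < N := by omega
  simp [shiftTuple, liftCurve, this, hol j hj]

end Curves

/-- For a regular Lagrangian, if curves `q_0, …, q_{2k-1}` satisfy the partial
holonomy conditions `q_i' = q_{i+1}` (`0 ≤ i ≤ k-1`) and the momenta
`p^i = p̂^i(t, q_0, …, q_{2k-1-i})` satisfy the momentum equations of the unified formalism,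
then the full holonomy conditions hold and `q_0` satisfies the Euler–Lagrange equation. -/
theorem stmt6 (n k : ℕ) (hn : 1 ≤ n) (hk : 1 ≤ k)
    (L : ℝ × (Fin (k+1) → Evec n) → ℝ) (hL : ContDiff ℝ ∞ L)
    (hreg : ∀ x : ℝ × (Fin (k+1) → Evec n), IsUnit (hessQk L x))
    (q : ℕ → ℝ → Evec n) (hq : ∀ i ≤ 2*k - 1, ContDiff ℝ ∞ (q i))
    (hqhol : ∀ i < k, ∀ t, deriv (q i) t = q (i+1) t)
    (p : ℕ → ℝ → Evec n)
    (hp : ∀ i, ∀ hik : i < k, ∀ t : ℝ, p i t =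
      hatP (by omega) L (i+1) (by omega) (by omega)
        (t, fun j : Fin (2*k) => q (j : ℕ) t))
    (hmom0 : ∀ t, deriv (p 0) t =
      pgradN L ⟨0, by omega⟩ (t, fun j : Fin (k+1) => q (j : ℕ) t))
    (hmomi : ∀ i, 1 ≤ i → ∀ hik : i ≤ k - 1, ∀ t,
      deriv (p i) t =
        pgradN L ⟨i, by omega⟩ (t, fun j : Fin (k+1) => q (j : ℕ) t) - p (i-1) t) :
    (∀ j, k ≤ j → ∀ hj : j ≤ 2*k - 2, ∀ t, deriv (q j) t = q (j+1) t) ∧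
    (∀ i ≤ 2*k - 1, ∀ t, q i t = iteratedDeriv i (q 0) t) ∧
    (∀ t, ∑ i : Fin (k+1), ((-1:ℝ)^(i : ℕ)) •
        iteratedDeriv (i : ℕ) (fun s => pgradN L i (jetN (k+1) (q 0) s)) t = 0) := by
  have hkN : k + 1 ≤ 2 * k := by omega
  have hq' : ∀ i < 2 * k, ContDiff ℝ ∞ (q i) := fun i hi => hq i (by omega)
  set γ := liftCurve (2 * k) q with hγ
  have hp' : ∀ i < k, p i = momentum hkN L (i + 1) ∘ γ := fun i hik => funext fun t => by
    rw [hp i hik, hatP_eq_momentum]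
    rfl
  have hgrad : ∀ i, ∀ hi : i < k + 1, ∀ t,
      pgradN L ⟨i, hi⟩ (t, fun j : Fin (k + 1) => q (j : ℕ) t) = gradQ hkN L i (γ t) := by
    intro i hi t
    rw [gradQ, dif_pos hi]
    rfl
  have hmom : ∀ d, d + 1 < k → ∀ t, deriv (momentum hkN L (k - d) ∘ γ) t =
      dT (momentum hkN L (k - d)) (γ t) := by
    intro d hd t
    have h1 := hmomi (k - 1 - d) (by omega) (by omega) t
    have h2 := congrFun (momentum_eq_sub hkN hL (r := k - 1 - d) (by omega)) (γ t)
    rw [hgrad, hp' _ (by omega), hp' _ (by omega), show k - 1 - d - 1 + 1 = k - 1 - d by omega,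
      Function.comp_apply, h2, show k - 1 - d + 1 = k - d by omega] at h1
    simpa using h1
  have hhol : ∀ d, d + 1 < k → ∀ t, deriv (q (k + d)) t = q (k + d + 1) t := by
    intro d
    induction d using Nat.strong_induction_on with
    | _ d ih =>
    intro hd t
    have hP := contDiff_momentum hkN hL (d := d) (by omega)
    have hPd := hP.differentiable (by simp) (γ t)
    have h1 := deriv_comp_liftCurve_sub_dT hq' hP t
    rw [hmom d hd t, sub_self] at h1
    set w : Fin (2 * k) → Evec n :=
      (fun j : Fin (2 * k) => deriv (q j) t) - shiftTuple (γ t).2 with hw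
    have hwj : ∀ j : Fin (2 * k), (j : ℕ) + 1 < 2 * k →
        w j = deriv (q j) t - q (j + 1) t := fun j hj => by
      simp [hw, shiftTuple, hγ, liftCurve, hj]
    have hlow : ∀ j : Fin (2 * k), (j : ℕ) < k + d → w j = 0 := by
      intro j hj
      rw [hwj j (by omega), sub_eq_zero]
      rcases lt_or_ge (j : ℕ) k with hjk | hjk
      · exact hqhol j hjk t
      · obtain ⟨e, he⟩ := Nat.exists_eq_add_of_le hjk
        rw [he]
        exact ih e (by omega) (by omega) t
    let J : Fin (2 * k) := ⟨k + d, by omega⟩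
    have hsplit : ((0 : ℝ), w) = (0, Pi.single J (w J)) + (0, w - Pi.single J (w J)) := by simp
    rw [hsplit, map_add, fderiv_momentum_top hkN hL (by omega) (by omega),
      (dependsUpTo_momentum hkN hL (by omega)).fderiv_apply_eq_zero hPd, add_zero] at h1
    · have h2 := eq_zero_of_fderiv_gradQ hkN hL hreg (γ t) (w J)
        ((smul_eq_zero.1 h1.symm).resolve_left (pow_ne_zero _ (by norm_num)))
      rw [hwj J (by simp only [J]; omega), sub_eq_zero] at h2
      exact h2
    · intro j hj
      rcases eq_or_ne j J with rfl | hne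
      · simp
      · have : (j : ℕ) ≠ k + d := fun e => hne (Fin.ext e)
        simp [hne, hlow j (by omega)]
  have hfull : ∀ j ≤ 2 * k - 2, ∀ t, deriv (q j) t = q (j + 1) t := by
    intro j hj t
    rcases lt_or_ge j k with hjk | hjk
    · exact hqhol j hjk t
    · obtain ⟨e, rfl⟩ := Nat.exists_eq_add_of_le hjk
      exact hhol e (by omega) t
  have hiter : ∀ i ≤ 2 * k - 1, q i = iteratedDeriv i (q 0) := by
    intro i
    induction i with
    | zero => simp
    | succ i ih =>
      intro hi
      rw [iteratedDeriv_succ, ← ih (by omega)]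
      exact funext fun t => (hfull i (by omega) t).symm
  refine ⟨fun j _ hj t => hfull j hj t, fun i hi t => congrFun (hiter i hi) t, fun t => ?_⟩
  have hγs : ContDiff ℝ ∞ γ := contDiff_liftCurve hq'
  have hgs : ∀ i, ContDiff ℝ ∞ (gradQ hkN L i ∘ γ) := fun i =>
    (contDiff_gradQ hkN hL i).comp hγs
  let E : ℕ → ℝ → Evec n := fun r =>
    ∑ i ∈ Finset.range (k + 1 - r), (-1 : ℝ) ^ i • deriv^[i] (gradQ hkN L (r + i) ∘ γ)
  have hE : ∀ r ≤ k, E r = gradQ hkN L r ∘ γ - deriv (E (r + 1)) := by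
    intro r hr
    have := alternating_deriv_sum_succ (fun i => gradQ hkN L (r + i) ∘ γ)
      (fun i => hgs _) (k - r)
    simp only [E]
    rw [show k + 1 - r = k - r + 1 by omega, show k + 1 - (r + 1) = k - r by omega]
    simpa [add_assoc, add_comm, add_left_comm] using this
  have hEP : ∀ d < k, E (k - d) = momentum hkN L (k - d) ∘ γ := by
    intro d
    induction d with
    | zero =>
      intro _
      simp [E, momentum_top hkN]
    | succ d ih =>
      intro hd
      rw [hE _ (by omega), momentum_eq_sub hkN hL (by omega),
        show k - (d + 1) + 1 = k - d by omega, ih (by omega)]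
      funext s
      simp [(dependsUpTo_momentum hkN hL (d := d) (by omega)).deriv_comp_liftCurve hq'
        (contDiff_momentum hkN hL (by omega)) (by omega) (fun j hj => hfull j (by omega) s), hγ]
  have hE1 : E 1 = p 0 := by
    rw [hp' 0 (by omega)]
    simpa [show k - (k - 1) = 1 by omega] using hEP (k - 1) (by omega)
  have hE0 : E 0 t = 0 := by
    rw [hE 0 (Nat.zero_le k), zero_add, hE1, Pi.sub_apply, hmom0 t, hgrad]
    simp
  rw [← hE0]
  simp only [E, Finset.sum_apply, Nat.sub_zero, zero_add]
  rw [← Fin.sum_univ_eq_sum_range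
    (fun i => ((-1 : ℝ) ^ i • deriv^[i] (gradQ hkN L i ∘ γ)) t)]
  refine Finset.sum_congr rfl fun i _ => ?_
  have : (fun s => pgradN L i (jetN (k + 1) (q 0) s)) = gradQ hkN L i ∘ γ := by
    funext s
    rw [Function.comp_apply, ← hgrad i i.isLt s]
    congr 1
    refine Prod.ext rfl (funext fun j => ?_)
    exact (congrFun (hiter j (by have := j.isLt; omega)) s).symm
  rw [this, iteratedDeriv_eq_iterate]
  rfl
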